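/- Let R = ℂ[[x₁,…,xₙ]] with maximal ideal 𝔪 = (x₁,…,xₙ), let I ⊆ R be an ideal with 𝔪^ℓ ⊆ I ⊆ 𝔪 for some ℓ ≥ 2, and set R̄ = R/𝔪^{ℓ+1} with Ī the image of I in R̄. Then 𝔪^{ℓ+1}·Der_ℂ R is a Lie ideal of Der_I R, and reduction of derivations modulo 𝔪^{ℓ+1} induces an injective homomorphism of Lie algebras (Der_I R)/(𝔪^{ℓ+1}·Der_ℂ R) ↪ Der_{Ī} R̄. -/

import Mathlib

set_option synthInstance.maxHeartbeats 1000000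
set_option maxHeartbeats 1000000

/-- The Lie subalgebra `Der_J R ⊆ Der_ℂ R` of `ℂ`-linear derivations of `R`
preserving the ideal `J`. -/
noncomputable def derPres {R : Type*} [CommRing R] [Algebra ℂ R] (J : Ideal R) :
    LieSubalgebra ℂ (Derivation ℂ R R) where
  carrier := {δ | ∀ a ∈ J, δ a ∈ J}
  add_mem' := by
    intro δ ε hδ hε a ha
    simpa using J.add_mem (hδ a ha) (hε a ha)
  smul_mem' := by
    intro c δ hδ a ha
    have : (c • δ) a = c • δ a := rfl
    rw [this, Algebra.smul_def]
    exact J.mul_mem_left _ (hδ a ha)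
  zero_mem' := by intro a ha; simp
  lie_mem' := by
    intro δ ε hδ hε a ha
    rw [Derivation.commutator_apply]
    exact J.sub_mem (hδ _ (hε a ha)) (hε _ (hδ a ha))

namespace MvPowerSeries

variable {σ R : Type*}

theorem coeff_X_mul_eq_ite [Semiring R] (i : σ) (f : MvPowerSeries σ R) (d : σ →₀ ℕ) :
    coeff d (X i * f) = if d i ≠ 0 then coeff (d - Finsupp.single i 1) f else 0 := by
  rw [X, coeff_monomial_mul]
  simp [Finsupp.single_le_iff, Nat.one_le_iff_ne_zero]

/-- In finitely many variables, a power series without constant term lies in the ideal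
generated by the variables. -/
theorem mem_span_range_X_of_constantCoeff_eq_zero [Finite σ] [CommSemiring R]
    {f : MvPowerSeries σ R} (hf : constantCoeff f = 0) :
    f ∈ Ideal.span (Set.range (X : σ → MvPowerSeries σ R)) := by
  classical
  have := Fintype.ofFinite σ
  cases isEmpty_or_nonempty σ with
  | inl h =>
    have : f = 0 := by
      ext d
      rw [Subsingleton.elim d 0, coeff_zero_eq_constantCoeff_apply, hf, map_zero]
    simp [this]
  | inr h =>
    have hex : ∀ d : σ →₀ ℕ, ∃ i, d ≠ 0 → d i ≠ 0 := by
      intro d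
      by_cases hd : d = 0
      · exact ⟨Classical.arbitrary σ, fun h => absurd hd h⟩
      · obtain ⟨i, hi⟩ := Finsupp.ne_iff.mp hd
        exact ⟨i, fun _ => hi⟩
    choose p hp using hex
    let g : σ → MvPowerSeries σ R := fun i d =>
      if p (d + Finsupp.single i 1) = i then coeff (d + Finsupp.single i 1) f else 0
    have hg : ∀ i d, coeff d (g i) =
        if p (d + Finsupp.single i 1) = i then coeff (d + Finsupp.single i 1) f else 0 :=
      fun _ _ => rfl
    have hfg : f = ∑ i, X i * g i := by
      ext d
      rw [map_sum]
      by_cases hd : d = 0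
      · subst hd
        simp [hf]
      · rw [Finset.sum_eq_single (p d)]
        · have hle : Finsupp.single (p d) 1 ≤ d := by
            simpa [Finsupp.single_le_iff, Nat.one_le_iff_ne_zero] using hp d hd
          rw [coeff_X_mul_eq_ite, if_pos (hp d hd), hg, tsub_add_cancel_of_le hle, if_pos rfl]
        · intro i _ hi
          rw [coeff_X_mul_eq_ite]
          split_ifs with hdi
          · have hle : Finsupp.single i 1 ≤ d := by
              simpa [Finsupp.single_le_iff, Nat.one_le_iff_ne_zero] using hdi
            rw [hg, tsub_add_cancel_of_le hle, if_neg (Ne.symm hi)]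
          · rfl
        · simp
    rw [hfg]
    exact Ideal.sum_mem _ fun i _ =>
      Ideal.mul_mem_right _ _ (Ideal.subset_span (Set.mem_range_self i))

theorem isUnit_of_notMem_span_range_X [Finite σ] {K : Type*} [Field K] {f : MvPowerSeries σ K}
    (hf : f ∉ Ideal.span (Set.range (X : σ → MvPowerSeries σ K))) : IsUnit f :=
  isUnit_iff_constantCoeff.mpr <| isUnit_iff_ne_zero.mpr fun h =>
    hf (mem_span_range_X_of_constantCoeff_eq_zero h)

theorem one_notMem_span_range_X [CommSemiring R] [Nontrivial R] :
    (1 : MvPowerSeries σ R) ∉ Ideal.span (Set.range (X : σ → MvPowerSeries σ R)) := by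
  intro h
  have hle : Ideal.span (Set.range (X : σ → MvPowerSeries σ R)) ≤
      RingHom.ker (constantCoeff (σ := σ) (R := R)) := by
    rw [Ideal.span_le]
    rintro _ ⟨i, rfl⟩
    simp [RingHom.mem_ker]
  simpa [RingHom.mem_ker] using hle h

/-- A derivation of a power series ring in finitely many variables which kills the variables
is zero. -/
theorem derivation_eq_zero_of_X [Finite σ] [CommRing R]
    {D : Derivation R (MvPowerSeries σ R) (MvPowerSeries σ R)} (hD : ∀ i, D (X i) = 0) :
    D = 0 := by
  have := Fintype.ofFinite σ
  have key : ∀ k : ℕ, ∀ f : MvPowerSeries σ R, ∀ d : σ →₀ ℕ, d.degree < k →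
      coeff d (D f) = 0 := by
    intro k
    induction k with
    | zero => intro f d hd; omega
    | succ k ih =>
      intro f d hd
      have hmem : f - C (constantCoeff f) ∈
          Ideal.span (Set.range (X : σ → MvPowerSeries σ R)) :=
        mem_span_range_X_of_constantCoeff_eq_zero (by simp)
      have hsub : D f = D (f - C (constantCoeff f)) := by
        have hC : D (C (constantCoeff f)) = 0 := D.map_algebraMap (constantCoeff f)
        rw [map_sub, hC, sub_zero]
      obtain ⟨c, hc⟩ := Ideal.mem_span_range_iff_exists_fun.mp hmem
      rw [hsub, ← hc, map_sum, map_sum]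
      refine Finset.sum_eq_zero fun i _ => ?_
      rw [Derivation.leibniz, hD, smul_zero, zero_add, smul_eq_mul, coeff_X_mul_eq_ite]
      split_ifs with hdi
      · apply ih
        have hle : Finsupp.single i 1 ≤ d := by
          simpa [Finsupp.single_le_iff, Nat.one_le_iff_ne_zero] using hdi
        have := congrArg Finsupp.degree (tsub_add_cancel_of_le hle)
        rw [map_add, Finsupp.degree_single] at this
        omega
      · rfl
  ext1 f
  ext d
  exact key _ f d (Nat.lt_succ_self _)

/-- A derivation of a power series ring in finitely many variables is the combination of the
partial derivatives with coefficients its values at the variables. -/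
theorem derivation_eq_sum_pderiv [Fintype σ] [CommRing R]
    (D : Derivation R (MvPowerSeries σ R) (MvPowerSeries σ R)) :
    D = ∑ i, D (X i) • pderiv R i := by
  classical
  rw [← sub_eq_zero]
  refine derivation_eq_zero_of_X fun j => ?_
  rw [Derivation.sub_apply, ← Derivation.coeFnAddMonoidHom_apply (∑ i, D (X i) • pderiv R i),
    map_sum, Finset.sum_apply, Finset.sum_eq_single j]
  · simp
  · intro i _ hij
    simp [pderiv_X_of_ne (Ne.symm hij)]
  · simp

end MvPowerSeries

namespace Derivation

variable {k A : Type*} [CommRing k] [CommRing A] [Algebra k A]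

theorem apply_mem_of_mem_smul_top {J : Ideal A} {D : Derivation k A A}
    (hD : D ∈ (J • ⊤ : Submodule A (Derivation k A A))) (a : A) : D a ∈ J := by
  induction hD using Submodule.smul_induction_on' with
  | smul r hr E _ => simpa using J.mul_mem_right _ hr
  | add E _ F _ hE hF => simpa using J.add_mem hE hF

theorem apply_mem_pow {J : Ideal A} {D : Derivation k A A} (hD : ∀ a ∈ J, D a ∈ J) (m : ℕ) :
    ∀ a ∈ J ^ m, D a ∈ J ^ m := by
  induction m with
  | zero => simp
  | succ m ih =>
    intro a ha
    rw [pow_succ] at ha ⊢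
    induction ha using Submodule.mul_induction_on' with
    | mem_mul_mem x hx y hy =>
      rw [leibniz, smul_eq_mul, smul_eq_mul, mul_comm y]
      exact add_mem (Ideal.mul_mem_mul hx (hD y hy)) (Ideal.mul_mem_mul (ih x hx) hy)
    | add x _ y _ hx hy => rw [map_add]; exact add_mem hx hy

theorem lie_mem_smul_top {J : Ideal A} {D E : Derivation k A A} (hD : ∀ a ∈ J, D a ∈ J)
    (hE : E ∈ (J • ⊤ : Submodule A (Derivation k A A))) :
    ⁅D, E⁆ ∈ (J • ⊤ : Submodule A (Derivation k A A)) := by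
  induction hE using Submodule.smul_induction_on' with
  | smul r hr F _ =>
    have h : ⁅D, r • F⁆ = D r • F + r • ⁅D, F⁆ := by
      ext a
      simp only [commutator_apply, smul_apply, add_apply, smul_eq_mul, leibniz]
      ring
    rw [h]
    exact add_mem (Submodule.smul_mem_smul (hD r hr) trivial)
      (Submodule.smul_mem_smul hr trivial)
  | add F _ G _ hF hG => rw [lie_add]; exact add_mem hF hG

/-- In characteristic zero, a derivation preserving an ideal `I ⊆ J` that contains a power of
`J` preserves `J`, provided the elements outside `J` are units. -/
theorem apply_mem_of_pow_le [Algebra ℚ A] {I J : Ideal A} (hJ : ∀ a ∉ J, IsUnit a)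
    (h1 : (1 : A) ∉ J) (hIJ : I ≤ J) {l : ℕ} (hl : J ^ l ≤ I) {D : Derivation k A A}
    (hD : ∀ a ∈ I, D a ∈ I) : ∀ a ∈ J, D a ∈ J := by
  classical
  intro a ha
  by_contra hDa
  have hex : ∃ m, a ^ m ∈ I := ⟨l, hl (Ideal.pow_mem_pow ha l)⟩
  obtain ⟨m, hm⟩ : ∃ m, Nat.find hex = m := ⟨_, rfl⟩
  have hmem : a ^ m ∈ I := hm ▸ Nat.find_spec hex
  cases m with
  | zero => exact h1 (hIJ (by simpa using hmem))
  | succ m =>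
    have h := hD _ hmem
    rw [leibniz_pow, Nat.add_sub_cancel, smul_eq_mul, nsmul_eq_mul, mul_left_comm] at h
    have hu : IsUnit (((m + 1 : ℕ) : A) * D a) := by
      refine IsUnit.mul ?_ (hJ _ hDa)
      have : IsUnit ((m + 1 : ℕ) : ℚ) := isUnit_iff_ne_zero.mpr (by positivity)
      simpa using this.map (algebraMap ℚ A)
    exact Nat.find_min hex (by omega) ((Ideal.mul_unit_mem_iff_mem I hu).mp h)

/-- The derivation of `A ⧸ J` induced by a derivation of `A` preserving `J`. -/
noncomputable def quotient (J : Ideal A) (D : Derivation k A A) (hD : ∀ a ∈ J, D a ∈ J) :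
    Derivation k (A ⧸ J) (A ⧸ J) :=
  liftOfSurjective (f := Ideal.Quotient.mkₐ k J) (Ideal.Quotient.mkₐ_surjective k J) (d := D)
    fun x hx => Ideal.Quotient.eq_zero_iff_mem.mpr (hD x (Ideal.Quotient.eq_zero_iff_mem.mp hx))

theorem quotient_mk (J : Ideal A) (D : Derivation k A A) (hD : ∀ a ∈ J, D a ∈ J) (a : A) :
    quotient J D hD (Ideal.Quotient.mk J a) = Ideal.Quotient.mk J (D a) :=
  liftOfSurjective_apply (f := Ideal.Quotient.mkₐ k J) (Ideal.Quotient.mkₐ_surjective k J)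
    (fun x hx => Ideal.Quotient.eq_zero_iff_mem.mpr
      (hD x (Ideal.Quotient.eq_zero_iff_mem.mp hx))) a

/-- Reduction modulo `J` of the derivations in a Lie subalgebra all of whose members
preserve `J`. -/
noncomputable def quotientLieHom (J : Ideal A) (L : LieSubalgebra k (Derivation k A A))
    (hL : ∀ D ∈ L, ∀ a ∈ J, D a ∈ J) : L →ₗ⁅k⁆ Derivation k (A ⧸ J) (A ⧸ J) where
  toFun D := quotient J D (hL D D.2)
  map_add' D E := by
    ext x
    obtain ⟨a, rfl⟩ := Ideal.Quotient.mk_surjective x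
    simp [quotient_mk]
  map_smul' c D := by
    ext x
    obtain ⟨a, rfl⟩ := Ideal.Quotient.mk_surjective x
    rw [RingHom.id_apply, smul_apply, quotient_mk, quotient_mk]
    rfl
  map_lie' {D E} := by
    ext x
    obtain ⟨a, rfl⟩ := Ideal.Quotient.mk_surjective x
    simp [quotient_mk, commutator_apply]

end Derivation

/-- Let `R = ℂ[[x₁,…,xₙ]]` with maximal ideal `𝔪`, `𝔪^ℓ ⊆ I ⊆ 𝔪` with `ℓ ≥ 2`,
`R̄ = R/𝔪^{ℓ+1}` and `Ī` the image of `I` in `R̄`. Then `𝔪^{ℓ+1}·Der_ℂ R` is a Lie ideal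
of `Der_I R`, and reduction of derivations modulo `𝔪^{ℓ+1}` is a Lie algebra homomorphism
`Der_I R → Der_ℂ R̄` landing in `Der_Ī R̄` whose kernel is exactly `𝔪^{ℓ+1}·Der_ℂ R`;
hence it induces an injective homomorphism of Lie algebras
`(Der_I R)/(𝔪^{ℓ+1}·Der_ℂ R) ↪ Der_Ī R̄`. -/
theorem derPres_reduction_injective
    (n : ℕ)
    (𝔪 : Ideal (MvPowerSeries (Fin n) ℂ))
    (h𝔪 : 𝔪 = Ideal.span (Set.range (MvPowerSeries.X : Fin n → MvPowerSeries (Fin n) ℂ)))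
    (I : Ideal (MvPowerSeries (Fin n) ℂ))
    (ℓ : ℕ) (hℓ : 2 ≤ ℓ) (hℓI : 𝔪 ^ ℓ ≤ I) (hI𝔪 : I ≤ 𝔪) :
    -- `𝔪^{ℓ+1}·Der_ℂ R ⊆ Der_I R`
    (∀ δ : Derivation ℂ (MvPowerSeries (Fin n) ℂ) (MvPowerSeries (Fin n) ℂ),
      δ ∈ ((𝔪 ^ (ℓ + 1)) • ⊤ : Submodule (MvPowerSeries (Fin n) ℂ)
        (Derivation ℂ (MvPowerSeries (Fin n) ℂ) (MvPowerSeries (Fin n) ℂ))) →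
      δ ∈ derPres I) ∧
    -- `𝔪^{ℓ+1}·Der_ℂ R` is a Lie ideal of `Der_I R`
    (∀ δ : Derivation ℂ (MvPowerSeries (Fin n) ℂ) (MvPowerSeries (Fin n) ℂ), δ ∈ derPres I →
      ∀ η : Derivation ℂ (MvPowerSeries (Fin n) ℂ) (MvPowerSeries (Fin n) ℂ),
        η ∈ ((𝔪 ^ (ℓ + 1)) • ⊤ : Submodule (MvPowerSeries (Fin n) ℂ)
          (Derivation ℂ (MvPowerSeries (Fin n) ℂ) (MvPowerSeries (Fin n) ℂ))) →
        ⁅δ, η⁆ ∈ ((𝔪 ^ (ℓ + 1)) • ⊤ : Submodule (MvPowerSeries (Fin n) ℂ)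
          (Derivation ℂ (MvPowerSeries (Fin n) ℂ) (MvPowerSeries (Fin n) ℂ)))) ∧
    -- reduction modulo `𝔪^{ℓ+1}`, with values preserving `Ī` and kernel `𝔪^{ℓ+1}·Der_ℂ R`
    (∃ φ : derPres I →ₗ⁅ℂ⁆
        Derivation ℂ (MvPowerSeries (Fin n) ℂ ⧸ 𝔪 ^ (ℓ + 1))
          (MvPowerSeries (Fin n) ℂ ⧸ 𝔪 ^ (ℓ + 1)),
      (∀ (δ : derPres I) (a : MvPowerSeries (Fin n) ℂ),
        φ δ (Ideal.Quotient.mk (𝔪 ^ (ℓ + 1)) a) =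
          Ideal.Quotient.mk (𝔪 ^ (ℓ + 1))
            ((δ : Derivation ℂ (MvPowerSeries (Fin n) ℂ) (MvPowerSeries (Fin n) ℂ)) a)) ∧
      (∀ δ : derPres I, ∀ b ∈ I.map (Ideal.Quotient.mk (𝔪 ^ (ℓ + 1))),
        φ δ b ∈ I.map (Ideal.Quotient.mk (𝔪 ^ (ℓ + 1)))) ∧
      (∀ δ : derPres I, φ δ = 0 ↔
        (δ : Derivation ℂ (MvPowerSeries (Fin n) ℂ) (MvPowerSeries (Fin n) ℂ)) ∈
          ((𝔪 ^ (ℓ + 1)) • ⊤ : Submodule (MvPowerSeries (Fin n) ℂ)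
            (Derivation ℂ (MvPowerSeries (Fin n) ℂ) (MvPowerSeries (Fin n) ℂ))))) := by
  subst h𝔪
  set 𝔪 := Ideal.span (Set.range (MvPowerSeries.X : Fin n → MvPowerSeries (Fin n) ℂ))
  have hpow : 𝔪 ^ (ℓ + 1) ≤ I := (Ideal.pow_le_pow_right ℓ.le_succ).trans hℓI
  have hpres : ∀ δ ∈ derPres I, ∀ a ∈ 𝔪 ^ (ℓ + 1), δ a ∈ 𝔪 ^ (ℓ + 1) := fun δ hδ =>
    Derivation.apply_mem_pow (Derivation.apply_mem_of_pow_le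
      (fun _ => MvPowerSeries.isUnit_of_notMem_span_range_X)
      MvPowerSeries.one_notMem_span_range_X hI𝔪 hℓI hδ) (ℓ + 1)
  refine ⟨fun δ hδ a _ => hpow (Derivation.apply_mem_of_mem_smul_top hδ a),
    fun δ hδ η hη => Derivation.lie_mem_smul_top (hpres δ hδ) hη,
    Derivation.quotientLieHom _ _ hpres,
    fun δ a => Derivation.quotient_mk _ _ (hpres δ δ.2) a, fun δ b hb => ?_, fun δ => ?_⟩
  · obtain ⟨a, ha, rfl⟩ :=
      (Ideal.mem_map_iff_of_surjective _ Ideal.Quotient.mk_surjective).mp hb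
    exact (Derivation.quotient_mk _ _ (hpres δ δ.2) a).symm ▸ Ideal.mem_map_of_mem _ (δ.2 a ha)
  · constructor
    · intro h
      rw [MvPowerSeries.derivation_eq_sum_pderiv δ.1]
      refine Submodule.sum_mem _ fun i _ => Submodule.smul_mem_smul ?_ trivial
      rw [← Ideal.Quotient.eq_zero_iff_mem, ← Derivation.quotient_mk _ _ (hpres δ δ.2)]
      exact DFunLike.congr_fun h _
    · intro h
      ext x
      obtain ⟨a, rfl⟩ := Ideal.Quotient.mk_surjective x
      exact (Derivation.quotient_mk _ _ (hpres δ δ.2) a).trans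
        (Ideal.Quotient.eq_zero_iff_mem.mpr (Derivation.apply_mem_of_mem_smul_top h a))
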